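/- Let m = (a₁, a₂, b, c) be an ADHM configuration with a₁ nilpotent, and let α₂, α₃ ∈ ℂ. Define the linear map 𝔄₁ : W ⊕ ℂʳ → W ⊕ W ⊕ ℂʳ by 𝔄₁(ξ, u) = ((1 − α₃a₁)ξ, (α₂ − α₃a₂)ξ − α₃(1 − α₃a₁)⁻¹(b u), α₃·c(ξ) + u). Then 𝔄₁ is injective and its range is exactly ker B_m(1, α₂, α₃). -/

import Mathlib

/-- The monad map `B_m(x₁,x₂,x₃) : W ⊕ W ⊕ ℂʳ → W` of an ADHM configuration. -/
noncomputable def adhmB {W : Type*} [AddCommGroup W] [Module ℂ W] {r : ℕ}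
    (a₁ a₂ : W →ₗ[ℂ] W) (b : (Fin r → ℂ) →ₗ[ℂ] W) (x₁ x₂ x₃ : ℂ) :
    (W × W × (Fin r → ℂ)) →ₗ[ℂ] W :=
  (x₃ • a₂ - x₂ • LinearMap.id).comp (LinearMap.fst ℂ W (W × (Fin r → ℂ)))
    + (x₁ • LinearMap.id - x₃ • a₁).comp
        ((LinearMap.fst ℂ W (Fin r → ℂ)).comp (LinearMap.snd ℂ W (W × (Fin r → ℂ))))
    + (x₃ • b).comp
        ((LinearMap.snd ℂ W (Fin r → ℂ)).comp (LinearMap.snd ℂ W (W × (Fin r → ℂ))))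

/-- The map `𝔄₁ : W ⊕ ℂʳ → W ⊕ W ⊕ ℂʳ`,
`(ξ, u) ↦ ((1 − α₃a₁)ξ, (α₂ − α₃a₂)ξ − α₃(1 − α₃a₁)⁻¹(b u), α₃·c(ξ) + u)`. -/
noncomputable def frakA1 {W : Type*} [AddCommGroup W] [Module ℂ W] {r : ℕ}
    (a₁ a₂ : Module.End ℂ W) (b : (Fin r → ℂ) →ₗ[ℂ] W) (c : W →ₗ[ℂ] (Fin r → ℂ))
    (α₂ α₃ : ℂ) :
    (W × (Fin r → ℂ)) →ₗ[ℂ] (W × W × (Fin r → ℂ)) :=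
  LinearMap.prod
    (((1 : Module.End ℂ W) - α₃ • a₁) ∘ₗ LinearMap.fst ℂ W (Fin r → ℂ))
    (LinearMap.prod
      ((α₂ • (1 : Module.End ℂ W) - α₃ • a₂) ∘ₗ LinearMap.fst ℂ W (Fin r → ℂ)
        - (α₃ • (Ring.inverse ((1 : Module.End ℂ W) - α₃ • a₁) ∘ₗ b))
            ∘ₗ LinearMap.snd ℂ W (Fin r → ℂ))
      ((α₃ • c) ∘ₗ LinearMap.fst ℂ W (Fin r → ℂ) + LinearMap.snd ℂ W (Fin r → ℂ)))

theorem adhmB_apply {W : Type*} [AddCommGroup W] [Module ℂ W] {r : ℕ}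
    (a₁ a₂ : Module.End ℂ W) (b : (Fin r → ℂ) →ₗ[ℂ] W) (x₁ x₂ x₃ : ℂ)
    (v₁ v₂ : W) (u : Fin r → ℂ) :
    adhmB a₁ a₂ b x₁ x₂ x₃ (v₁, v₂, u)
      = (x₃ • a₂ v₁ - x₂ • v₁) + (x₁ • v₂ - x₃ • a₁ v₂) + x₃ • b u :=
  rfl

theorem frakA1_apply {W : Type*} [AddCommGroup W] [Module ℂ W] {r : ℕ}
    (a₁ a₂ : Module.End ℂ W) (b : (Fin r → ℂ) →ₗ[ℂ] W) (c : W →ₗ[ℂ] (Fin r → ℂ))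
    (α₂ α₃ : ℂ) (ξ : W) (u : Fin r → ℂ) :
    frakA1 a₁ a₂ b c α₂ α₃ (ξ, u)
      = ((1 - α₃ • a₁) ξ,
          (α₂ • ξ - α₃ • a₂ ξ) - α₃ • Ring.inverse (1 - α₃ • a₁) (b u),
          α₃ • c ξ + u) :=
  rfl

theorem adhmB_frakA1 {W : Type*} [AddCommGroup W] [Module ℂ W] {r : ℕ}
    (a₁ a₂ : Module.End ℂ W) (b : (Fin r → ℂ) →ₗ[ℂ] W) (c : W →ₗ[ℂ] (Fin r → ℂ))
    (hint : a₁ * a₂ - a₂ * a₁ + b ∘ₗ c = 0) (α₂ α₃ : ℂ)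
    (hu : IsUnit (1 - α₃ • a₁)) (ξ : W) (u : Fin r → ℂ) :
    adhmB a₁ a₂ b 1 α₂ α₃ (frakA1 a₁ a₂ b c α₂ α₃ (ξ, u)) = 0 := by
  rw [frakA1_apply, adhmB_apply]
  have hinv := LinearMap.congr_fun (Ring.mul_inverse_cancel _ hu) (b u)
  have hc := LinearMap.congr_fun hint ξ
  simp only [Module.End.mul_apply, LinearMap.sub_apply, LinearMap.smul_apply,
    Module.End.one_apply, LinearMap.add_apply, LinearMap.comp_apply,
    LinearMap.zero_apply] at hinv hc ⊢
  set w := Ring.inverse (1 - α₃ • a₁) (b u)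
  simp only [map_sub, map_smul, map_add]
  linear_combination (norm := module) (α₃ * α₃) • hc - α₃ • hinv

/-- For an ADHM configuration with `a₁` nilpotent, the map `𝔄₁` is
injective with range exactly `ker B_m(1, α₂, α₃)`. -/
theorem frakA1_injective_range_eq_ker
    {W : Type*} [AddCommGroup W] [Module ℂ W] [FiniteDimensional ℂ W]
    {r : ℕ} (hr : 1 ≤ r)
    (a₁ a₂ : Module.End ℂ W) (b : (Fin r → ℂ) →ₗ[ℂ] W) (c : W →ₗ[ℂ] (Fin r → ℂ))
    (hint : a₁ * a₂ - a₂ * a₁ + b ∘ₗ c = 0)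
    (hn₁ : IsNilpotent a₁)
    (α₂ α₃ : ℂ) :
    Function.Injective (frakA1 a₁ a₂ b c α₂ α₃)
      ∧ LinearMap.range (frakA1 a₁ a₂ b c α₂ α₃)
          = LinearMap.ker (adhmB a₁ a₂ b 1 α₂ α₃) := by
  have hu : IsUnit (1 - α₃ • a₁) := (hn₁.smul α₃).isUnit_one_sub
  have hinj : Function.Injective (1 - α₃ • a₁ : Module.End ℂ W) :=
    ((Module.End.isUnit_iff _).1 hu).injective
  constructor
  · rw [← LinearMap.ker_eq_bot, LinearMap.ker_eq_bot']
    rintro ⟨ξ, u⟩ h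
    rw [frakA1_apply, Prod.mk_eq_zero, Prod.mk_eq_zero] at h
    obtain ⟨h₁, -, h₃⟩ := h
    have hξ : ξ = 0 := hinj (h₁.trans (map_zero _).symm)
    subst hξ
    simpa using h₃
  · refine le_antisymm ?_ ?_
    · rintro _ ⟨⟨ξ, u⟩, rfl⟩
      exact adhmB_frakA1 a₁ a₂ b c hint α₂ α₃ hu ξ u
    · rintro ⟨v₁, v₂, u⟩ h
      obtain ⟨ξ, rfl⟩ := ((Module.End.isUnit_iff _).1 hu).surjective v₁
      have h' := adhmB_frakA1 a₁ a₂ b c hint α₂ α₃ hu ξ (u - α₃ • c ξ)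
      refine ⟨(ξ, u - α₃ • c ξ), ?_⟩
      rw [LinearMap.mem_ker, adhmB_apply] at h
      rw [frakA1_apply, add_sub_cancel] at h' ⊢
      rw [adhmB_apply] at h'
      have h₂ := add_left_cancel (add_right_cancel (h'.trans h.symm))
      rw [one_smul, one_smul] at h₂
      exact congrArg (fun v ↦ ((1 - α₃ • a₁) ξ, v, u)) (hinj h₂)
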